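/- arXiv:2604.04493 — 3 statements merged into one kernel-verified Lean document; each statement's English description precedes it below -/
import Mathlib

section
/- Let n ≥ 2 and let w_0 ≤ w_1 ≤ … ≤ w_{n−1} be real numbers, not all equal. Define f(a,b) = Σ_{k=0}^{n−1} min{(w_k − a)², (w_k − b)²}. If (ã, b̃) is a global minimizer of f over ℝ² with ã ≤ b̃ and ã ≠ b̃, then there exists an index t ∈ {0, 1, …, n−2} such that w_t ≤ (ã + b̃)/2 ≤ w_{t+1}, ã = (Σ_{k=0}^{t} w_k)/(t+1), and b̃ = (Σ_{k=t+1}^{n−1} w_k)/(n−t−1). -/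
/-- A sequence nondecreasing below `n` splits at any threshold `m`. -/
theorem exists_threshold_split (n : ℕ) (w : ℕ → ℝ)
    (hsorted : ∀ k, k + 1 < n → w k ≤ w (k + 1)) (m : ℝ) :
    ∃ s ≤ n, (∀ k < s, w k ≤ m) ∧ ∀ k, s ≤ k → k < n → m ≤ w k := by
  classical
  by_cases h : ∃ k, k < n ∧ m < w k
  · refine ⟨Nat.find h, (Nat.find_spec h).1.le, fun k hk => ?_, fun k hk => ?_⟩
    · have hk' := Nat.find_min h hk
      have hlt := hk.trans (Nat.find_spec h).1
      exact not_lt.1 fun hm => hk' ⟨hlt, hm⟩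
    · induction k, hk using Nat.le_induction with
      | base => exact fun _ => (Nat.find_spec h).2.le
      | succ k _ ih => exact fun hkn => (ih (by omega)).trans (hsorted k hkn)
  · push Not at h
    exact ⟨n, le_rfl, h, fun k h₁ h₂ => by omega⟩

/-- The sum of squared deviations from `c` decomposes around any `μ` with `#s * μ = ∑ w`. -/
theorem sum_sub_sq_eq_add_card_mul {ι : Type*} (s : Finset ι) (w : ι → ℝ) (c μ : ℝ)
    (hμ : (s.card : ℝ) * μ = ∑ k ∈ s, w k) :
    ∑ k ∈ s, (w k - c) ^ 2 = ∑ k ∈ s, (w k - μ) ^ 2 + s.card * (c - μ) ^ 2 := by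
  have h : ∀ k ∈ s, (w k - c) ^ 2 = (w k - μ) ^ 2 + (2 * (μ - c) * w k + (c ^ 2 - μ ^ 2)) :=
    fun k _ => by ring
  rw [Finset.sum_congr rfl h, Finset.sum_add_distrib, Finset.sum_add_distrib, ← Finset.mul_sum,
    ← hμ, Finset.sum_const, nsmul_eq_mul]
  ring

/-- If a single center `c` achieves the optimal two-center cost, all the points equal `c`. -/
theorem eq_of_sum_sq_le_two_center {ι : Type*} (s : Finset ι) (w : ι → ℝ) (c : ℝ)
    (h : ∀ y, ∑ k ∈ s, (w k - c) ^ 2 ≤ ∑ k ∈ s, min ((w k - c) ^ 2) ((w k - y) ^ 2)) :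
    ∀ i ∈ s, w i = c := by
  intro i hi
  by_contra hne
  refine (h (w i)).not_gt (Finset.sum_lt_sum (fun k _ => min_le_left _ _) ⟨i, hi, ?_⟩)
  refine (min_le_right _ _).trans_lt ?_
  have := sq_pos_of_ne_zero (sub_ne_zero.2 hne)
  simpa using this

/-- For sorted reals `w 0 ≤ … ≤ w (n-1)` (`n ≥ 2`), not all equal,
if `(a, b)` with `a ≤ b`, `a ≠ b` is a global minimizer of
`f (x, y) = ∑ k, min ((w k - x)², (w k - y)²)`, then there is `t ∈ {0, …, n-2}` with
`w t ≤ (a+b)/2 ≤ w (t+1)`, `a` the mean of the first `t+1` values and `b` the mean of the rest. -/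
theorem stmt_0 (n : ℕ) (hn : 2 ≤ n) (w : ℕ → ℝ)
    (hsorted : ∀ k, k + 1 < n → w k ≤ w (k + 1))
    (hne : ∃ i, i < n ∧ ∃ j, j < n ∧ w i ≠ w j)
    (a b : ℝ) (hab : a ≤ b) (hab' : a ≠ b)
    (hmin : ∀ x y : ℝ,
      (∑ k ∈ Finset.range n, min ((w k - a) ^ 2) ((w k - b) ^ 2)) ≤
        ∑ k ∈ Finset.range n, min ((w k - x) ^ 2) ((w k - y) ^ 2)) :
    ∃ t, t + 1 < n ∧ w t ≤ (a + b) / 2 ∧ (a + b) / 2 ≤ w (t + 1) ∧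
      a = (∑ k ∈ Finset.range (t + 1), w k) / ((t : ℝ) + 1) ∧
      b = (∑ k ∈ Finset.Ico (t + 1) n, w k) / ((n : ℝ) - (t : ℝ) - 1) := by
  have hlt : a < b := lt_of_le_of_ne hab hab'
  obtain ⟨s, hsn, hs₁, hs₂⟩ := exists_threshold_split n w hsorted ((a + b) / 2)
  have hcost : (∑ k ∈ Finset.range n, min ((w k - a) ^ 2) ((w k - b) ^ 2)) =
      ∑ k ∈ Finset.range s, (w k - a) ^ 2 + ∑ k ∈ Finset.Ico s n, (w k - b) ^ 2 := by
    rw [← Finset.sum_range_add_sum_Ico _ hsn]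
    congr 1
    · refine Finset.sum_congr rfl fun k hk => min_eq_left ?_
      nlinarith [hs₁ k (Finset.mem_range.1 hk)]
    · refine Finset.sum_congr rfl fun k hk => min_eq_right ?_
      obtain ⟨h₁, h₂⟩ := Finset.mem_Ico.1 hk
      nlinarith [hs₂ k h₁ h₂]
  have hnot : ∀ c, ¬ ∀ i ∈ Finset.range n, w i = c := by
    intro c hc
    obtain ⟨i, hi, j, hj, hij⟩ := hne
    exact hij ((hc i (Finset.mem_range.2 hi)).trans (hc j (Finset.mem_range.2 hj)).symm)
  have hs0 : s ≠ 0 := by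
    rintro rfl
    refine hnot b (eq_of_sum_sq_le_two_center _ w b fun y => ?_)
    simpa [hcost, ← Finset.range_eq_Ico] using hmin b y
  have hsn' : s ≠ n := by
    rintro rfl
    refine hnot a (eq_of_sum_sq_le_two_center _ w a fun y => ?_)
    simpa [hcost] using hmin a y
  obtain ⟨t, rfl⟩ := Nat.exists_eq_succ_of_ne_zero hs0
  have htn : t + 1 < n := lt_of_le_of_ne hsn hsn'
  have ht : (0 : ℝ) < t + 1 := by positivity
  have hnt : (0 : ℝ) < n - t - 1 := by
    have : ((t + 1 : ℕ) : ℝ) < n := by exact_mod_cast htn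
    push_cast at this
    linarith
  have hc₁ : ((Finset.range (t + 1)).card : ℝ) = t + 1 := by simp
  have hc₂ : ((Finset.Ico (t + 1) n).card : ℝ) = n - t - 1 := by
    rw [Nat.card_Ico, Nat.cast_sub htn.le]
    push_cast
    ring
  refine ⟨t, htn, hs₁ t (Nat.lt_succ_self t), hs₂ (t + 1) le_rfl htn, ?_⟩
  set A := (∑ k ∈ Finset.range (t + 1), w k) / ((t : ℝ) + 1) with hA
  set B := (∑ k ∈ Finset.Ico (t + 1) n, w k) / ((n : ℝ) - (t : ℝ) - 1) with hB
  have hle : (∑ k ∈ Finset.range n, min ((w k - A) ^ 2) ((w k - B) ^ 2)) ≤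
      ∑ k ∈ Finset.range (t + 1), (w k - A) ^ 2 + ∑ k ∈ Finset.Ico (t + 1) n, (w k - B) ^ 2 := by
    rw [← Finset.sum_range_add_sum_Ico _ hsn]
    exact add_le_add (Finset.sum_le_sum fun k _ => min_le_left _ _)
      (Finset.sum_le_sum fun k _ => min_le_right _ _)
  have hdev₁ := sum_sub_sq_eq_add_card_mul (Finset.range (t + 1)) w a A
    (by rw [hc₁, hA, mul_div_cancel₀ _ ht.ne'])
  have hdev₂ := sum_sub_sq_eq_add_card_mul (Finset.Ico (t + 1) n) w b B
    (by rw [hc₂, hB, mul_div_cancel₀ _ hnt.ne'])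
  rw [hc₁] at hdev₁
  rw [hc₂] at hdev₂
  have hopt := (hmin A B).trans hle
  rw [hcost, Nat.succ_eq_add_one, hdev₁, hdev₂] at hopt
  have hpa := mul_nonneg ht.le (sq_nonneg (a - A))
  have hpb := mul_nonneg hnt.le (sq_nonneg (b - B))
  have hza : ((t : ℝ) + 1) * (a - A) ^ 2 = 0 := by linarith
  have hzb : ((n : ℝ) - t - 1) * (b - B) ^ 2 = 0 := by linarith
  exact ⟨sub_eq_zero.1 (pow_eq_zero_iff two_ne_zero |>.1 ((mul_eq_zero.1 hza).resolve_left ht.ne')),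
    sub_eq_zero.1 (pow_eq_zero_iff two_ne_zero |>.1 ((mul_eq_zero.1 hzb).resolve_left hnt.ne'))⟩
end

section
/- Let n ≥ 2 and let w_0 ≤ w_1 ≤ … ≤ w_{n−1} be real numbers, and let f(a,b) = Σ_{k=0}^{n−1} min{(w_k − a)², (w_k − b)²}. For every (a,b) ∈ ℝ², clamping both coordinates to the interval [w_0, w_{n−1}] does not increase f: f(max(w_0, min(a, w_{n−1})), max(w_0, min(b, w_{n−1}))) ≤ f(a,b). -/
/-- Clamping `a` to `[lo, hi]` does not increase its squared distance to a point of `[lo, hi]`. -/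
theorem sq_sub_clamp_le {lo hi x : ℝ} (hlo : lo ≤ x) (hhi : x ≤ hi) (a : ℝ) :
    (x - max lo (min a hi)) ^ 2 ≤ (x - a) ^ 2 := by
  rcases le_total a hi with h | h
  · rw [min_eq_left h]
    rcases le_total lo a with h' | h'
    · rw [max_eq_right h']
    · rw [max_eq_left h']
      nlinarith
  · rw [min_eq_right h, max_eq_right (hlo.trans hhi)]
    nlinarith

/-- A real sequence increasing step by step below `n` is monotone on the indices below `n`. -/
theorem le_of_le_succ_of_lt {n : ℕ} {w : ℕ → ℝ} (hw : ∀ k, k + 1 < n → w k ≤ w (k + 1))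
    {i j : ℕ} (hij : i ≤ j) (hj : j < n) : w i ≤ w j := by
  induction j, hij using Nat.le_induction with
  | base => exact le_rfl
  | succ k _ ih => exact (ih (by omega)).trans (hw k hj)

/-- For sorted reals `w 0 ≤ … ≤ w (n-1)` (`n ≥ 2`) and
`f (x, y) = ∑ k, min ((w k - x)², (w k - y)²)`, clamping both coordinates to
`[w 0, w (n-1)]` does not increase `f`. -/
theorem stmt_2 (n : ℕ) (hn : 2 ≤ n) (w : ℕ → ℝ)
    (hsorted : ∀ k, k + 1 < n → w k ≤ w (k + 1)) :
    ∀ a b : ℝ,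
      (∑ k ∈ Finset.range n,
          min ((w k - max (w 0) (min a (w (n - 1)))) ^ 2)
            ((w k - max (w 0) (min b (w (n - 1)))) ^ 2)) ≤
        ∑ k ∈ Finset.range n, min ((w k - a) ^ 2) ((w k - b) ^ 2) := by
  intro a b
  refine Finset.sum_le_sum fun k hk => ?_
  have hkn : k < n := Finset.mem_range.mp hk
  have hlo : w 0 ≤ w k := le_of_le_succ_of_lt hsorted k.zero_le hkn
  have hhi : w k ≤ w (n - 1) := le_of_le_succ_of_lt hsorted (by omega) (by omega)
  exact min_le_min (sq_sub_clamp_le hlo hhi a) (sq_sub_clamp_le hlo hhi b)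
end

section
/- Let A be a real m × n matrix with every entry nonnegative, and let B be a real m × n matrix with rank(B) ≤ 1 that minimizes ‖C − A‖_F over all real m × n matrices C with rank(C) ≤ 1. Then the entrywise absolute value matrix |B| also has rank at most 1 and is also a minimizer: ‖|B| − A‖_F = ‖B − A‖_F ≤ ‖C − A‖_F for every rank-at-most-1 matrix C. In particular, A admits a best rank-1 Frobenius approximation with all entries nonnegative. -/
/-- The Frobenius norm of a real `m × n` matrix: `‖M‖_F = sqrt (∑ i j, (M i j)²)`. -/
noncomputable def frobeniusNorm {m n : ℕ} (M : Matrix (Fin m) (Fin n) ℝ) : ℝ :=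
  Real.sqrt (∑ i, ∑ j, (M i j) ^ 2)

/-- A matrix over a field with rank at most one is an outer product. -/
theorem Matrix.exists_eq_vecMulVec_of_rank_le_one {ι κ K : Type*} [Fintype κ] [Finite ι] [Field K]
    (M : Matrix ι κ K) (hM : M.rank ≤ 1) : ∃ (u : ι → K) (v : κ → K), M = vecMulVec u v := by
  rw [Matrix.rank_eq_finrank_span_cols, finrank_le_one_iff] at hM
  obtain ⟨u, hu⟩ := hM
  choose v hv using fun j => hu ⟨M.col j, Submodule.subset_span ⟨j, rfl⟩⟩
  refine ⟨u, v, ?_⟩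
  ext i j
  have h := congrFun (congrArg Subtype.val (hv j)) i
  simpa [vecMulVec_apply, mul_comm] using h.symm

theorem Matrix.rank_abs_le_one {ι κ : Type*} [Fintype κ] [Finite ι]
    (M : Matrix ι κ ℝ) (hM : M.rank ≤ 1) : (Matrix.of fun i j => |M i j|).rank ≤ 1 := by
  obtain ⟨u, v, rfl⟩ := M.exists_eq_vecMulVec_of_rank_le_one hM
  have h : (Matrix.of fun i j => |vecMulVec u v i j|) =
      vecMulVec (fun i => |u i|) (fun j => |v j|) := by
    ext i j
    simp [vecMulVec_apply, abs_mul]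
  rw [h]
  exact rank_vecMulVec_le _ _

/-- Taking entrywise absolute values does not increase the distance to a nonnegative matrix. -/
theorem frobeniusNorm_abs_sub_le {m n : ℕ} (A B : Matrix (Fin m) (Fin n) ℝ)
    (hA : ∀ i j, 0 ≤ A i j) :
    frobeniusNorm ((Matrix.of fun i j => |B i j|) - A) ≤ frobeniusNorm (B - A) := by
  refine Real.sqrt_le_sqrt (Finset.sum_le_sum fun i _ => Finset.sum_le_sum fun j _ => ?_)
  simp only [Matrix.sub_apply, Matrix.of_apply]
  nlinarith [mul_le_mul_of_nonneg_left (le_abs_self (B i j)) (hA i j), sq_abs (B i j)]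

/-- Let `A` be entrywise nonnegative and let `B` with `rank B ≤ 1`
minimize `‖C - A‖_F` over all matrices `C` with `rank C ≤ 1`.  Then the entrywise
absolute value `|B|` also has rank at most 1, satisfies `‖|B| - A‖_F = ‖B - A‖_F`,
and is also a minimizer.  In particular `A` has a best rank-1 Frobenius
approximation with all entries nonnegative. -/
theorem stmt_10 {m n : ℕ} (A B : Matrix (Fin m) (Fin n) ℝ)
    (hA : ∀ i j, 0 ≤ A i j) (hB : B.rank ≤ 1)
    (hmin : ∀ C : Matrix (Fin m) (Fin n) ℝ, C.rank ≤ 1 →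
      frobeniusNorm (B - A) ≤ frobeniusNorm (C - A)) :
    (Matrix.of fun i j => |B i j|).rank ≤ 1 ∧
      frobeniusNorm ((Matrix.of fun i j => |B i j|) - A) = frobeniusNorm (B - A) ∧
      (∀ C : Matrix (Fin m) (Fin n) ℝ, C.rank ≤ 1 →
        frobeniusNorm ((Matrix.of fun i j => |B i j|) - A) ≤ frobeniusNorm (C - A)) := by
  have hrank := B.rank_abs_le_one hB
  have hle := frobeniusNorm_abs_sub_le A B hA
  exact ⟨hrank, hle.antisymm (hmin _ hrank), fun C hC => hle.trans (hmin C hC)⟩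
end
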